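/- Let ρ*: ℝ^{N_e} → ℝ^{N_e} be continuously differentiable (the filter map), let K: ℝ^{N_e} → ℝ^{n×n} be a twice continuously differentiable map whose values are symmetric positive definite matrices, f ∈ ℝⁿ, and let j: ℝⁿ × ℝ^{N_e} → ℝ be twice continuously differentiable. Fix ψ ∈ ℝ^{N_e} and write ρ := ρ*(ψ), r(w; ρ) := K(ρ) w − f. Let u* := K(ρ)⁻¹ f, let λ* solve K(ρ) λ* = (∂j/∂u)(u*, ρ)ᵀ, let u_k, λ_k ∈ ℝⁿ be the Galerkin ROM primal and adjoint solutions for a basis Φ with linearly independent columns, and let r^adj(v) := K(ρ) v − (∂j/∂u)(u_k, ρ)ᵀ. Define J(ψ) := j(u*(ρ*(ψ)), ρ*(ψ)) and J_k(ψ) := j(u_k(ρ*(ψ)), ρ*(ψ)), with gradients computed by the adjoint formula ∇J = (∂ρ*/∂ψ)ᵀ((∂j/∂ρ)ᵀ − (∂r/∂ρ)ᵀ λ*) and its ROM analogue with (u_k, λ_k). Define matrices C, D ∈ ℝ^{N_e×n} by C_{pm} := −(∂ρ*_q/∂ψ_p) [ ∫₀¹ (∂²j/∂ρ_q∂u_s)(θu*+(1−θ)u_k)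 dθ − λ_{k,i} ∫₀¹ (∂²r_i/∂ρ_q∂u_s)(θu*+(1−θ)u_k) dθ − (∂r_i/∂ρ_q)(u*) (K⁻¹)_{il} ∫₀¹ (∂²j/∂u_l∂u_s)(θu*+(1−θ)u_k) dθ ] (K⁻¹)_{sm} and D_{pm} := (∂ρ*_q/∂ψ_p)(∂r_i/∂ρ_q)(u*)(K⁻¹)_{im} (sum over repeated indices, all quantities evaluated at ψ and ρ*(ψ)). Then ‖∇J(ψ) − ∇J_k(ψ)‖₂ ≤ σ_max(C) ‖r(u_k; ρ)‖₂ + σ_max(D) ‖r^adj(λ_k)‖₂. -/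

import Mathlib

open Matrix

/-- Euclidean (ℓ²) norm of a vector in `ℝⁿ`. -/
noncomputable def l2norm {n : ℕ} (v : Fin n → ℝ) : ℝ :=
  ‖(WithLp.equiv 2 (Fin n → ℝ)).symm v‖

/-- Largest singular value of a (rectangular) matrix: the operator norm of the induced
linear map between Euclidean spaces. -/
noncomputable def sigmaMax {m n : ℕ} (A : Matrix (Fin m) (Fin n) ℝ) : ℝ :=
  ‖LinearMap.toContinuousLinearMap (Matrix.toEuclideanLin A)‖

theorem l2norm_add_le {n : ℕ} (v w : Fin n → ℝ) : l2norm (v + w) ≤ l2norm v + l2norm w :=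
  norm_add_le _ _

theorem l2norm_mulVec_le {m n : ℕ} (A : Matrix (Fin m) (Fin n) ℝ) (v : Fin n → ℝ) :
    l2norm (A *ᵥ v) ≤ sigmaMax A * l2norm v :=
  (LinearMap.toContinuousLinearMap (Matrix.toEuclideanLin A)).le_opNorm (WithLp.toLp 2 v)

/-- Mean value theorem in integral form for a `C¹` map whose Jacobian is the matrix `M`. -/
theorem sub_eq_integral_jacobian_mulVec {m n : ℕ} {g : (Fin n → ℝ) → (Fin m → ℝ)}
    (hg : ContDiff ℝ 1 g) {M : (Fin n → ℝ) → Matrix (Fin m) (Fin n) ℝ}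
    (hM : ∀ u v, fderiv ℝ g u v = M u *ᵥ v) (a b : Fin n → ℝ) :
    g a - g b =
      (Matrix.of fun l s => ∫ θ in (0:ℝ)..1, M (θ • a + (1 - θ) • b) l s) *ᵥ (a - b) := by
  have hpath : Continuous fun θ : ℝ => θ • a + (1 - θ) • b := by fun_prop
  have hcont : ∀ l s, Continuous fun θ : ℝ => M (θ • a + (1 - θ) • b) l s := by
    intro l s
    have hentry : ∀ u, M u l s = fderiv ℝ g u (Pi.single s 1) l := by
      intro u
      rw [hM, Matrix.mulVec_single_one, Matrix.col_apply]
    simp only [hentry]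
    have h1 : Continuous fun u => fderiv ℝ g u := hg.continuous_fderiv one_ne_zero
    exact (continuous_apply l).comp ((h1.comp hpath).clm_apply continuous_const)
  ext l
  have hderiv : ∀ θ : ℝ, HasDerivAt (fun θ : ℝ => g (θ • a + (1 - θ) • b) l)
      ((M (θ • a + (1 - θ) • b) *ᵥ (a - b)) l) θ := by
    intro θ
    have h1 : HasDerivAt (fun θ : ℝ => θ • a + (1 - θ) • b) (a - b) θ := by
      have := ((hasDerivAt_id' θ).smul_const a).add
        (((hasDerivAt_id' θ).const_sub 1).smul_const b)
      rwa [one_smul, neg_one_smul, ← sub_eq_add_neg] at this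
    have h2 := ((hg.differentiable one_ne_zero (θ • a + (1 - θ) • b)).hasFDerivAt).comp_hasDerivAt
      θ h1
    rw [hM] at h2
    exact hasDerivAt_pi.1 h2 l
  have hsum : (fun θ : ℝ => (M (θ • a + (1 - θ) • b) *ᵥ (a - b)) l) =
      fun θ => ∑ s, M (θ • a + (1 - θ) • b) l s * (a - b) s := rfl
  have hint := intervalIntegral.integral_eq_sub_of_hasDerivAt (fun θ _ => hderiv θ)
    (a := 0) (b := 1) (Continuous.intervalIntegrable (by
      rw [hsum]; exact continuous_finsetSum _ fun s _ => (hcont l s).mul continuous_const) _ _)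
  rw [hsum, intervalIntegral.integral_finsetSum (f := fun s θ =>
    M (θ • a + (1 - θ) • b) l s * (a - b) s) fun s _ =>
    ((hcont l s).mul continuous_const).intervalIntegrable _ _] at hint
  simp only [intervalIntegral.integral_mul_const] at hint
  simpa [Matrix.mulVec, dotProduct] using hint.symm

/-- For each parameter direction, the difference of adjoint sensitivities in terms of the primal
and adjoint residuals. -/
theorem sensitivity_sub_eq {n : ℕ} {K : Matrix (Fin n) (Fin n) ℝ} (hK : IsUnit K.det)
    (A H : Matrix (Fin n) (Fin n) ℝ) {f g us uk ls lk bs bk : Fin n → ℝ} {cs ck : ℝ}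
    (hus : K *ᵥ us = f) (hls : K *ᵥ ls = bs) (hb : bs - bk = H *ᵥ (us - uk))
    (hc : cs - ck = g ⬝ᵥ (us - uk)) :
    (cs - ls ⬝ᵥ (A *ᵥ us)) - (ck - lk ⬝ᵥ (A *ᵥ uk)) =
      -(((g - lk ᵥ* A - (A *ᵥ us) ᵥ* (K⁻¹ * H)) ᵥ* K⁻¹) ⬝ᵥ (K *ᵥ uk - f))
        + ((A *ᵥ us) ᵥ* K⁻¹) ⬝ᵥ (K *ᵥ lk - bk) := by
  have hr : K⁻¹ *ᵥ (K *ᵥ uk - f) = -(us - uk) := by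
    rw [← hus, ← Matrix.mulVec_sub, Matrix.mulVec_mulVec, Matrix.nonsing_inv_mul _ hK,
      Matrix.one_mulVec, neg_sub]
  have hl : K⁻¹ *ᵥ (K *ᵥ lk - bk) = lk - ls + K⁻¹ *ᵥ (H *ᵥ (us - uk)) := by
    have h : K *ᵥ lk - bk = K *ᵥ (lk - ls) + H *ᵥ (us - uk) := by
      rw [← hb, Matrix.mulVec_sub, hls]; abel
    rw [h, Matrix.mulVec_add, Matrix.mulVec_mulVec, Matrix.nonsing_inv_mul _ hK,
      Matrix.one_mulVec]
  have hcs : cs = ck + g ⬝ᵥ (us - uk) := by linarith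
  rw [← Matrix.dotProduct_mulVec, ← Matrix.dotProduct_mulVec, hr, hl, hcs]
  simp only [dotProduct_neg, sub_dotProduct, dotProduct_sub, dotProduct_add,
    ← Matrix.dotProduct_mulVec, ← Matrix.mulVec_mulVec, Matrix.mulVec_sub]
  rw [dotProduct_comm ls, dotProduct_comm (A *ᵥ us) lk]
  ring

/-- gradient error bound for the ROM objective in density-based topology
optimization.  `ρ*` is the (C¹) filter map with Jacobian `Dρ` at `ψ` (`Dρ q p = ∂ρ*_q/∂ψ_p`),
`K(ρ)` is a twice continuously differentiable SPD-matrix-valued map with partial derivatives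
`DK ρ q = ∂K/∂ρ_q`, `j(u, ρ)` is C² with partial gradients `ju = (∂j/∂u)ᵀ`, `jρ = (∂j/∂ρ)ᵀ`
and second partials `Juu = ∂²j/∂u∂u`, `Jρu = ∂²j/∂ρ∂u`; `u*` is the exact solution of
`K(ρ) u = f` at `ρ = ρ*(ψ)`, `λ*` the exact adjoint, and `u_k = Φ û`, `λ_k = Φ λ̂` the
Galerkin ROM primal/adjoint solutions.  The adjoint-formula gradients
`∇J = (∂ρ*/∂ψ)ᵀ((∂j/∂ρ)ᵀ − (∂r/∂ρ)ᵀ λ*)` (and its ROM analogue) satisfy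
`‖∇J(ψ) − ∇J_k(ψ)‖₂ ≤ σ_max(C) ‖r(u_k; ρ)‖₂ + σ_max(D) ‖r^adj(λ_k)‖₂`
with `C`, `D` as in the paper. -/
theorem stmt7 {Ne n k : ℕ}
    (ρstar : (Fin Ne → ℝ) → (Fin Ne → ℝ)) (hρC1 : ContDiff ℝ 1 ρstar)
    (K : (Fin Ne → ℝ) → Matrix (Fin n) (Fin n) ℝ)
    (hKC2 : ∀ a b, ContDiff ℝ 2 (fun ρ => K ρ a b))
    (hKpd : ∀ ρ, (K ρ).PosDef)
    (f : Fin n → ℝ)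
    (j : (Fin n → ℝ) → (Fin Ne → ℝ) → ℝ)
    (hjC2 : ContDiff ℝ 2 (fun p : (Fin n → ℝ) × (Fin Ne → ℝ) => j p.1 p.2))
    -- partial gradient of `j` with respect to `u`
    (ju : (Fin n → ℝ) → (Fin Ne → ℝ) → (Fin n → ℝ))
    (hju : ∀ u ρ (v : Fin n → ℝ), fderiv ℝ (fun w => j w ρ) u v = ju u ρ ⬝ᵥ v)
    -- partial gradient of `j` with respect to `ρ`
    (jρ : (Fin n → ℝ) → (Fin Ne → ℝ) → (Fin Ne → ℝ))
    (hjρ : ∀ u ρ (v : Fin Ne → ℝ), fderiv ℝ (fun r => j u r) ρ v = jρ u ρ ⬝ᵥ v)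
    -- second partials `∂²j/∂u∂u` and `∂²j/∂ρ∂u`
    (Juu : (Fin n → ℝ) → (Fin Ne → ℝ) → Matrix (Fin n) (Fin n) ℝ)
    (hJuu : ∀ u ρ (v : Fin n → ℝ), fderiv ℝ (fun w => ju w ρ) u v = (Juu u ρ).mulVec v)
    (Jρu : (Fin n → ℝ) → (Fin Ne → ℝ) → Matrix (Fin Ne) (Fin n) ℝ)
    (hJρu : ∀ u ρ (v : Fin n → ℝ), fderiv ℝ (fun w => jρ w ρ) u v = (Jρu u ρ).mulVec v)
    -- partial derivatives `∂K/∂ρ_q` of the stiffness matrix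
    (DK : (Fin Ne → ℝ) → Fin Ne → Matrix (Fin n) (Fin n) ℝ)
    (hDK : ∀ ρ q a b, DK ρ q a b = fderiv ℝ (fun r => K r a b) ρ (Pi.single q 1))
    -- the fixed design point and filtered density
    (ψ ρ0 : Fin Ne → ℝ) (hρ0 : ρ0 = ρstar ψ)
    -- Jacobian `Dρ q p = ∂ρ*_q/∂ψ_p` of the filter at `ψ`
    (Dρ : Matrix (Fin Ne) (Fin Ne) ℝ)
    (hDρ : ∀ q p, Dρ q p = fderiv ℝ (fun x => ρstar x q) ψ (Pi.single p 1))
    -- exact primal and adjoint solutions at `ρ0`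
    (ustar lamstar : Fin n → ℝ)
    (hustar : ustar = (K ρ0)⁻¹.mulVec f)
    (hlamstar : (K ρ0).mulVec lamstar = ju ustar ρ0)
    -- Galerkin ROM primal and adjoint solutions
    (Φ : Matrix (Fin n) (Fin k) ℝ) (hΦ : LinearIndependent ℝ Φ.transpose)
    (uhat : Fin k → ℝ)
    (huhat : (Φ.transpose * K ρ0 * Φ).mulVec uhat = Φ.transpose.mulVec f)
    (uk : Fin n → ℝ) (huk : uk = Φ.mulVec uhat)
    (lamhat : Fin k → ℝ)
    (hlamhat : (Φ.transpose * K ρ0 * Φ).mulVec lamhat = Φ.transpose.mulVec (ju uk ρ0))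
    (lamk : Fin n → ℝ) (hlamk : lamk = Φ.mulVec lamhat)
    -- adjoint-formula gradients of the HDM and ROM objectives
    (gradJ gradJk : Fin Ne → ℝ)
    (hgradJ : gradJ = fun p => ∑ q, Dρ q p *
      (jρ ustar ρ0 q - ∑ i, lamstar i * ((DK ρ0 q).mulVec ustar) i))
    (hgradJk : gradJk = fun p => ∑ q, Dρ q p *
      (jρ uk ρ0 q - ∑ i, lamk i * ((DK ρ0 q).mulVec uk) i))
    -- the matrices C and D of the bound
    (C : Matrix (Fin Ne) (Fin n) ℝ)
    (hC : C = Matrix.of fun p m => - ∑ q, Dρ q p * ∑ s,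
      ((∫ θ in (0:ℝ)..1, Jρu (θ • ustar + (1 - θ) • uk) ρ0 q s)
        - (∑ i, lamk i * ∫ θ in (0:ℝ)..1, DK ρ0 q i s)
        - (∑ i, ((DK ρ0 q).mulVec ustar) i * ∑ l, (K ρ0)⁻¹ i l *
            ∫ θ in (0:ℝ)..1, Juu (θ • ustar + (1 - θ) • uk) ρ0 l s)) * (K ρ0)⁻¹ s m)
    (D : Matrix (Fin Ne) (Fin n) ℝ)
    (hD : D = Matrix.of fun p m => ∑ q, Dρ q p *
      ∑ i, ((DK ρ0 q).mulVec ustar) i * (K ρ0)⁻¹ i m) :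
    l2norm (gradJ - gradJk) ≤
      sigmaMax C * l2norm ((K ρ0).mulVec uk - f)
        + sigmaMax D * l2norm ((K ρ0).mulVec lamk - ju uk ρ0) := by
  have hdet : IsUnit (K ρ0).det := (Matrix.isUnit_iff_isUnit_det _).1 (hKpd ρ0).isUnit
  have hus : K ρ0 *ᵥ ustar = f := by
    rw [hustar, Matrix.mulVec_mulVec, Matrix.mul_nonsing_inv _ hdet, Matrix.one_mulVec]
  have hF' : ContDiff ℝ 1 (fderiv ℝ fun p : (Fin n → ℝ) × (Fin Ne → ℝ) => j p.1 p.2) :=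
    hjC2.fderiv_right (by norm_num)
  have hFd : Differentiable ℝ fun p : (Fin n → ℝ) × (Fin Ne → ℝ) => j p.1 p.2 :=
    hjC2.differentiable two_ne_zero
  have hjuC1 : ContDiff ℝ 1 fun w => ju w ρ0 := by
    refine contDiff_pi.2 fun i => ?_
    have h : (fun w => ju w ρ0 i) = fun w => fderiv ℝ
        (fun p : (Fin n → ℝ) × (Fin Ne → ℝ) => j p.1 p.2) (w, ρ0) (Pi.single i 1, 0) := by
      ext w
      have h1 := (HasFDerivAt.comp (f := fun e => (e, ρ0)) w (hFd (w, ρ0)).hasFDerivAt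
        (hasFDerivAt_prodMk_left w ρ0)).fderiv
      have h2 := hju w ρ0 (Pi.single i 1)
      rw [dotProduct_single_one] at h2
      rw [← h2]
      exact congrArg (fun L => L (Pi.single i 1)) h1
    rw [h]
    exact (hF'.comp (contDiff_id.prodMk contDiff_const)).clm_apply contDiff_const
  have hjρC1 : ContDiff ℝ 1 fun w => jρ w ρ0 := by
    refine contDiff_pi.2 fun q => ?_
    have h : (fun w => jρ w ρ0 q) = fun w => fderiv ℝ
        (fun p : (Fin n → ℝ) × (Fin Ne → ℝ) => j p.1 p.2) (w, ρ0) (0, Pi.single q 1) := by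
      ext w
      have h1 := ((hFd (w, ρ0)).hasFDerivAt.comp ρ0 (hasFDerivAt_prodMk_right w ρ0)).fderiv
      have h2 := hjρ w ρ0 (Pi.single q 1)
      rw [dotProduct_single_one] at h2
      rw [← h2]
      exact congrArg (fun L => L (Pi.single q 1)) h1
    rw [h]
    exact (hF'.comp (contDiff_id.prodMk contDiff_const)).clm_apply contDiff_const
  have hu := sub_eq_integral_jacobian_mulVec hjuC1 (fun u v => hJuu u ρ0 v) ustar uk
  have hρ := sub_eq_integral_jacobian_mulVec hjρC1 (fun u v => hJρu u ρ0 v) ustar uk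
  set H : Matrix (Fin n) (Fin n) ℝ :=
    Matrix.of fun l s => ∫ θ in (0:ℝ)..1, Juu (θ • ustar + (1 - θ) • uk) ρ0 l s with hH
  set G : Matrix (Fin Ne) (Fin n) ℝ :=
    Matrix.of fun q s => ∫ θ in (0:ℝ)..1, Jρu (θ • ustar + (1 - θ) • uk) ρ0 q s with hG
  have hCrow : ∀ p, C p = -∑ q, Dρ q p • ((G q - lamk ᵥ* DK ρ0 q -
      (DK ρ0 q *ᵥ ustar) ᵥ* ((K ρ0)⁻¹ * H)) ᵥ* (K ρ0)⁻¹) := by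
    intro p
    ext m
    have hswap : ∀ q s, ((DK ρ0 q *ᵥ ustar) ᵥ* ((K ρ0)⁻¹ * H)) s =
        ∑ i, (DK ρ0 q *ᵥ ustar) i * ∑ l, (K ρ0)⁻¹ i l * H l s := fun _ _ => rfl
    have hentry : ∀ (x : Fin n → ℝ), (x ᵥ* (K ρ0)⁻¹) m = ∑ s, x s * (K ρ0)⁻¹ s m := fun _ => rfl
    have hlam : ∀ q s, (lamk ᵥ* DK ρ0 q) s = ∑ i, lamk i * DK ρ0 q i s := fun _ _ => rfl
    simp only [hC, Matrix.of_apply, Pi.neg_apply, Finset.sum_apply, Pi.smul_apply, smul_eq_mul,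
      intervalIntegral.integral_const, sub_zero, one_mul, hentry, Pi.sub_apply, hswap, hlam]
    simp only [hH, hG, Matrix.of_apply]
  have hDrow : ∀ p, D p = ∑ q, Dρ q p • ((DK ρ0 q *ᵥ ustar) ᵥ* (K ρ0)⁻¹) := by
    intro p
    ext m
    simp [hD, Matrix.vecMul, dotProduct]
  have key : gradJ - gradJk =
      C *ᵥ (K ρ0 *ᵥ uk - f) + D *ᵥ (K ρ0 *ᵥ lamk - ju uk ρ0) := by
    ext p
    have hsens : ∀ q, _ := fun q => sensitivity_sub_eq hdet (DK ρ0 q) H (lk := lamk) hus hlamstar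
      hu (congrFun hρ q : jρ ustar ρ0 q - jρ uk ρ0 q = G q ⬝ᵥ (ustar - uk))
    change gradJ p - gradJk p =
      C p ⬝ᵥ (K ρ0 *ᵥ uk - f) + D p ⬝ᵥ (K ρ0 *ᵥ lamk - ju uk ρ0)
    rw [hCrow, hDrow, neg_dotProduct, sum_dotProduct, sum_dotProduct, hgradJ, hgradJk,
      ← Finset.sum_sub_distrib, ← Finset.sum_neg_distrib, ← Finset.sum_add_distrib]
    refine Finset.sum_congr rfl fun q _ => ?_
    rw [← mul_sub, smul_dotProduct, smul_dotProduct, smul_eq_mul, smul_eq_mul, ← mul_neg,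
      ← mul_add]
    exact congrArg (Dρ q p * ·) (hsens q)
  rw [key]
  exact (l2norm_add_le _ _).trans <| add_le_add (l2norm_mulVec_le _ _) (l2norm_mulVec_le _ _)
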